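/- Let π be a permutation of {1,…,n} that avoids the pattern 1432. Then every reduced pipe dream C for π satisfies the TSSCPP inequalities: writing y_{i,j} = 1 when (i,j) ∈ C and y_{i,j} = 0 otherwise, for all 1 ≤ i < j ≤ n−1 one has 1 + Σ_{k=1}^{i} y_{j−k,k} ≥ Σ_{k=1}^{i+1} y_{j−k+1,k}. Consequently, the set of pipe dreams satisfying the TSSCPP inequalities that are reduced pipe dreams for π is exactly the set of all reduced pipe dreams for π. -/

import Mathlib

/-- `C` is a pipe dream of size `n`: a set of cross positions `(i,j)` in the
staircase `{(i,j) : i ≥ 1, j ≥ 1, i + j ≤ n}`. -/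
def IsPipeDream (n : ℕ) (C : Finset (ℕ × ℕ)) : Prop :=
  ∀ p ∈ C, 1 ≤ p.1 ∧ 1 ≤ p.2 ∧ p.1 + p.2 ≤ n

/-- The reading word of a pipe dream: scan rows `i = n-1, …, 1` from bottom to top,
within each row scan columns `j` in increasing order, and record `i + j - 1`
for each cross `(i,j) ∈ C`.  (Here row `r+1` for `r = n-2, …, 0` and column `c+1`,
recording `(r+1) + (c+1) - 1 = r + c + 1`.) -/
def readingWord (n : ℕ) (C : Finset (ℕ × ℕ)) : List ℕ :=
  (List.range (n - 1)).reverse.flatMap fun r =>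
    (List.range n).filterMap fun c =>
      if (r + 1, c + 1) ∈ C then some (r + c + 1) else none

/-- `C` is pseudo-Yamanouchi: for every prefix of the reading word and every
`1 ≤ j ≤ n - 2`, the number of occurrences of `j+1` is at most `1` plus the
number of occurrences of `j`. -/
def PseudoYamanouchi (n : ℕ) (C : Finset (ℕ × ℕ)) : Prop :=
  ∀ k j : ℕ, 1 ≤ j → j ≤ n - 2 →
    ((readingWord n C).take k).count (j + 1) ≤ 1 + ((readingWord n C).take k).count j

/-- `C` satisfies the TSSCPP inequalities: with `y` the 0-1 indicator of `C`,
for all `1 ≤ i < j ≤ n-1`, `1 + Σ_{k=1}^{i} y_{j-k,k} ≥ Σ_{k=1}^{i+1} y_{j-k+1,k}`. -/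
def SatisfiesTSSCPP (n : ℕ) (C : Finset (ℕ × ℕ)) : Prop :=
  ∀ i j : ℕ, 1 ≤ i → i < j → j ≤ n - 1 →
    (∑ k ∈ Finset.Icc 1 (i + 1), if (j - k + 1, k) ∈ C then (1 : ℕ) else 0) ≤
      1 + ∑ k ∈ Finset.Icc 1 i, if (j - k, k) ∈ C then (1 : ℕ) else 0

/-- `π` (a permutation of `{1,…,n}`) avoids the pattern 1432: there are no
`a < b < c < d` in `{1,…,n}` with `π a < π d < π c < π b`. -/
def Avoids1432 (n : ℕ) (π : Equiv.Perm ℕ) : Prop :=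
  ¬ ∃ a b c d : ℕ, 1 ≤ a ∧ a < b ∧ b < c ∧ c < d ∧ d ≤ n ∧
      π a < π d ∧ π d < π c ∧ π c < π b

/-- `C` is a reduced pipe dream for `π`: the product of the adjacent
transpositions `s_{a_1} ⋯ s_{a_ℓ}` along the reading word of `C` equals `π`
(where `s_a` swaps `a` and `a+1`), and the length `ℓ` of the reading word equals
the number of inversions of `π`. -/
def IsReducedPipeDream (n : ℕ) (π : Equiv.Perm ℕ) (C : Finset (ℕ × ℕ)) : Prop :=
  IsPipeDream n C ∧
  ((readingWord n C).map fun a => Equiv.swap a (a + 1)).prod = π ∧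
  (readingWord n C).length =
    ((Finset.Icc 1 n ×ˢ Finset.Icc 1 n).filter fun p => p.1 < p.2 ∧ π p.2 < π p.1).card

/-- The product of the adjacent transpositions indexed by the letters of a word. -/
def wordPerm (l : List ℕ) : Equiv.Perm ℕ :=
  (l.map fun a => Equiv.swap a (a + 1)).prod

@[simp] lemma wordPerm_nil : wordPerm [] = 1 := rfl

@[simp] lemma wordPerm_cons (a : ℕ) (l : List ℕ) :
    wordPerm (a :: l) = Equiv.swap a (a + 1) * wordPerm l := by
  simp [wordPerm]

@[simp] lemma wordPerm_append (l l' : List ℕ) :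
    wordPerm (l ++ l') = wordPerm l * wordPerm l' := by
  simp [wordPerm]

/-- Multiplying `σ` on the right by the letters of the word, one after the other, creates an
inversion at every step. -/
def IsAscending : Equiv.Perm ℕ → List ℕ → Prop
  | _, [] => True
  | σ, a :: l => σ a < σ (a + 1) ∧ IsAscending (σ * Equiv.swap a (a + 1)) l

lemma isAscending_append {σ : Equiv.Perm ℕ} {l l' : List ℕ} :
    IsAscending σ (l ++ l') ↔ IsAscending σ l ∧ IsAscending (σ * wordPerm l) l' := by
  induction l generalizing σ with
  | nil => simp [IsAscending]
  | cons a l ih => simp [IsAscending, ih, mul_assoc, and_assoc]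

/-- The inversions of `σ` among the positions `1, …, n`. -/
def inversions (n : ℕ) (σ : Equiv.Perm ℕ) : Finset (ℕ × ℕ) :=
  (Finset.Icc 1 n ×ˢ Finset.Icc 1 n).filter fun p => p.1 < p.2 ∧ σ p.2 < σ p.1

lemma mem_inversions {n : ℕ} {σ : Equiv.Perm ℕ} {p q : ℕ} : (p, q) ∈ inversions n σ ↔
    ((1 ≤ p ∧ p ≤ n) ∧ 1 ≤ q ∧ q ≤ n) ∧ p < q ∧ σ q < σ p := by
  simp [inversions]

lemma swap_succ_cases (a x : ℕ) :
    (x = a ∧ Equiv.swap a (a + 1) x = a + 1) ∨ (x = a + 1 ∧ Equiv.swap a (a + 1) x = a) ∨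
      (x ≠ a ∧ x ≠ a + 1 ∧ Equiv.swap a (a + 1) x = x) := by
  rw [Equiv.swap_apply_def]
  split_ifs <;> omega

lemma card_inversions_mul_swap_erase_le {n a : ℕ} (h1 : 1 ≤ a) (hn : a + 1 ≤ n)
    (σ : Equiv.Perm ℕ) :
    ((inversions n (σ * Equiv.swap a (a + 1))).erase (a, a + 1)).card ≤
      (inversions n σ).card := by
  refine Finset.card_le_card_of_injOn
    (fun p => (Equiv.swap a (a + 1) p.1, Equiv.swap a (a + 1) p.2)) ?_ ?_
  · rintro ⟨p, q⟩ h
    simp only [Finset.mem_coe, Finset.mem_erase, mem_inversions, Equiv.Perm.mul_apply, ne_eq,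
      Prod.mk.injEq] at h ⊢
    obtain ⟨hne, ⟨hp, hq⟩, hlt, hσ⟩ := h
    refine ⟨?_, ?_, hσ⟩ <;>
    · rcases swap_succ_cases a p with h | h | h <;> rcases swap_succ_cases a q with h' | h' | h' <;>
        omega
  · rintro ⟨p, q⟩ _ ⟨p', q'⟩ _ h
    simpa using h

lemma card_inversions_mul_swap_le {n a : ℕ} (h1 : 1 ≤ a) (hn : a + 1 ≤ n) (σ : Equiv.Perm ℕ) :
    (inversions n (σ * Equiv.swap a (a + 1))).card ≤ (inversions n σ).card + 1 :=
  Nat.sub_le_iff_le_add.1 (Finset.pred_card_le_card_erase.trans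
    (card_inversions_mul_swap_erase_le h1 hn σ))

lemma card_inversions_mul_swap_le_of_lt {n a : ℕ} (h1 : 1 ≤ a) (hn : a + 1 ≤ n)
    {σ : Equiv.Perm ℕ} (h : σ (a + 1) < σ a) :
    (inversions n (σ * Equiv.swap a (a + 1))).card ≤ (inversions n σ).card := by
  have hnot : (a, a + 1) ∉ inversions n (σ * Equiv.swap a (a + 1)) := by
    simp [mem_inversions, h.le]
  simpa [Finset.erase_eq_of_notMem hnot] using card_inversions_mul_swap_erase_le h1 hn σ

lemma card_inversions_mul_wordPerm_le {n : ℕ} {l : List ℕ} (hl : ∀ a ∈ l, 1 ≤ a ∧ a + 1 ≤ n)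
    (σ : Equiv.Perm ℕ) :
    (inversions n (σ * wordPerm l)).card ≤ (inversions n σ).card + l.length := by
  induction l generalizing σ with
  | nil => simp
  | cons a l ih =>
    have ha := hl a (by simp)
    have h := ih (fun b hb => hl b (by simp [hb])) (σ * Equiv.swap a (a + 1))
    have h' := card_inversions_mul_swap_le ha.1 ha.2 σ
    simp only [wordPerm_cons, List.length_cons, ← mul_assoc]
    omega

lemma isAscending_of_le_card {n : ℕ} {l : List ℕ} (hl : ∀ a ∈ l, 1 ≤ a ∧ a + 1 ≤ n)
    {σ : Equiv.Perm ℕ}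
    (h : (inversions n σ).card + l.length ≤ (inversions n (σ * wordPerm l)).card) :
    IsAscending σ l := by
  induction l generalizing σ with
  | nil => trivial
  | cons a l ih =>
    have ha := hl a (by simp)
    have hl' : ∀ b ∈ l, 1 ≤ b ∧ b + 1 ≤ n := fun b hb => hl b (by simp [hb])
    have hle := card_inversions_mul_wordPerm_le hl' (σ * Equiv.swap a (a + 1))
    have hstep := card_inversions_mul_swap_le ha.1 ha.2 σ
    simp only [wordPerm_cons, List.length_cons, ← mul_assoc] at h
    refine ⟨?_, ih hl' (by omega)⟩
    by_contra hcon
    have hne : σ a ≠ σ (a + 1) := by simp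
    have := card_inversions_mul_swap_le_of_lt ha.1 ha.2 (σ := σ) (by omega)
    omega

/-- In a reduced word, a pair of values that has been inverted stays inverted. -/
lemma IsAscending.inv_lt_inv {l : List ℕ} {σ : Equiv.Perm ℕ} (h : IsAscending σ l) {x y : ℕ}
    (hxy : x < y) (hσ : σ⁻¹ y < σ⁻¹ x) : (σ * wordPerm l)⁻¹ y < (σ * wordPerm l)⁻¹ x := by
  induction l generalizing σ with
  | nil => simpa using hσ
  | cons a l ih =>
    rw [wordPerm_cons, ← mul_assoc]
    refine ih h.2 ?_
    have h1 : ∀ v, (σ * Equiv.swap a (a + 1))⁻¹ v = Equiv.swap a (a + 1) (σ⁻¹ v) := by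
      simp [mul_inv_rev]
    rw [h1, h1]
    by_cases hc : σ⁻¹ y = a ∧ σ⁻¹ x = a + 1
    · have hlt := h.1
      rw [← hc.2, ← hc.1] at hlt
      simp only [Equiv.Perm.coe_inv, Equiv.apply_symm_apply] at hlt
      omega
    · rcases swap_succ_cases a (σ⁻¹ y) with h | h | h <;>
        rcases swap_succ_cases a (σ⁻¹ x) with h' | h' | h' <;> omega

lemma wordPerm_apply_of_ne {l : List ℕ} {x : ℕ} (h : ∀ a ∈ l, a ≠ x ∧ a + 1 ≠ x) :
    wordPerm l x = x := by
  induction l with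
  | nil => simp
  | cons a l ih =>
    have ha := h a (by simp)
    rw [wordPerm_cons, Equiv.Perm.mul_apply, ih fun b hb => h b (by simp [hb]),
      Equiv.swap_apply_of_ne_of_ne ha.1.symm ha.2.symm]

lemma wordPerm_inv_lt {l : List ℕ} {x j : ℕ} (h : ∀ a ∈ l, a + 1 ≠ j) (hx : x < j) :
    (wordPerm l)⁻¹ x < j := by
  induction l generalizing x with
  | nil => simpa using hx
  | cons a l ih =>
    have ha := h a (by simp)
    have : (wordPerm (a :: l))⁻¹ x = (wordPerm l)⁻¹ (Equiv.swap a (a + 1) x) := by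
      simp [mul_inv_rev]
    rw [this]
    refine ih (fun b hb => h b (by simp [hb])) ?_
    rcases swap_succ_cases a x with h | h | h <;> omega

/-- The values among `1, …, t` standing to the left of the value `z` in `σ`. -/
def valuesBefore (t z : ℕ) (σ : Equiv.Perm ℕ) : Finset ℕ :=
  (Finset.Icc 1 t).filter fun v => σ⁻¹ v < σ⁻¹ z

lemma valuesBefore_subset_mul_swap {t z a : ℕ} {σ : Equiv.Perm ℕ} (h : a + 1 ≠ σ⁻¹ z) :
    valuesBefore t z σ ⊆ valuesBefore t z (σ * Equiv.swap a (a + 1)) := by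
  intro v hv
  simp only [valuesBefore, Finset.mem_filter, mul_inv_rev, Equiv.swap_inv,
    Equiv.Perm.mul_apply] at hv ⊢
  refine ⟨hv.1, ?_⟩
  have := hv.2
  rcases swap_succ_cases a (σ⁻¹ v) with h | h | h <;>
    rcases swap_succ_cases a (σ⁻¹ z) with h' | h' | h' <;> omega

lemma card_valuesBefore_le_mul_swap {t z a : ℕ} (σ : Equiv.Perm ℕ) :
    (valuesBefore t z σ).card ≤
      (valuesBefore t z (σ * Equiv.swap a (a + 1))).card + 1 := by
  refine Nat.sub_le_iff_le_add.1 ((Finset.pred_card_le_card_erase (a := σ a)).trans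
    (Finset.card_le_card ?_))
  intro v hv
  simp only [valuesBefore, Finset.mem_erase, Finset.mem_filter, mul_inv_rev, Equiv.swap_inv,
    Equiv.Perm.mul_apply] at hv ⊢
  refine ⟨hv.2.1, ?_⟩
  have hlt := hv.2.2
  have hne : σ⁻¹ v ≠ a := by
    rintro rfl
    simp at hv
  rcases swap_succ_cases a (σ⁻¹ v) with h | h | h <;>
    rcases swap_succ_cases a (σ⁻¹ z) with h' | h' | h' <;> omega

lemma valuesBefore_subset_of_sorted {t z : ℕ} {l : List ℕ} (hs : l.Pairwise (· < ·))
    {σ : Equiv.Perm ℕ} (h : ∀ a ∈ l, σ⁻¹ z ≤ a) :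
    valuesBefore t z σ ⊆ valuesBefore t z (σ * wordPerm l) := by
  induction l generalizing σ with
  | nil => simp
  | cons a l ih =>
    rw [List.pairwise_cons] at hs
    have ha := h a (by simp)
    rw [wordPerm_cons, ← mul_assoc]
    refine (valuesBefore_subset_mul_swap (a := a) (by omega)).trans (ih hs.2 ?_)
    intro b hb
    have hab := hs.1 b hb
    simp only [mul_inv_rev, Equiv.swap_inv, Equiv.Perm.mul_apply]
    rcases swap_succ_cases a (σ⁻¹ z) with h' | h' | h' <;> omega

/-- Along an increasing word, at most one value passes `z` from left to right. -/
lemma card_valuesBefore_le_of_sorted {t z : ℕ} {l : List ℕ} (hs : l.Pairwise (· < ·))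
    (σ : Equiv.Perm ℕ) :
    (valuesBefore t z σ).card ≤ (valuesBefore t z (σ * wordPerm l)).card + 1 := by
  induction l generalizing σ with
  | nil => simp
  | cons a l ih =>
    rw [List.pairwise_cons] at hs
    rw [wordPerm_cons, ← mul_assoc]
    by_cases ha : a + 1 = σ⁻¹ z
    · refine (card_valuesBefore_le_mul_swap (a := a) σ).trans (Nat.add_le_add_right
        (Finset.card_le_card (valuesBefore_subset_of_sorted hs.2 ?_)) 1)
      intro b hb
      have hab := hs.1 b hb
      simp only [mul_inv_rev, Equiv.swap_inv, Equiv.Perm.mul_apply, ← ha]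
      simpa using hab.le
    · exact (Finset.card_le_card (valuesBefore_subset_mul_swap ha)).trans (ih hs.2 _)

lemma card_valuesBefore_le_of_flatMap {t z : ℕ} {f : ℕ → List ℕ}
    (hf : ∀ r, (f r).Pairwise (· < ·)) (L : List ℕ) (σ : Equiv.Perm ℕ) :
    (valuesBefore t z σ).card ≤ (valuesBefore t z (σ * wordPerm (L.flatMap f))).card + L.length := by
  induction L generalizing σ with
  | nil => simp
  | cons r L ih =>
    have h1 := card_valuesBefore_le_of_sorted (t := t) (z := z) (hf r) σ
    have h2 := ih (σ * wordPerm (f r))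
    simp only [List.flatMap_cons, wordPerm_append, List.length_cons, ← mul_assoc]
    omega

/-- A word decomposition forcing the pattern 1432. -/
lemma exists_pattern_of_word {f : ℕ → List ℕ} (hf : ∀ r, (f r).Pairwise (· < ·))
    {A M B L : List ℕ} {j t : ℕ} (htj : t < j) (hL : L.length < t)
    (hA : ∀ a ∈ A, t < a) (hM : ∀ a ∈ M, a ≠ j ∧ a + 1 ≠ j) (hB : ∀ a ∈ B, j < a)
    (hasc : IsAscending 1 (A ++ j :: (M ++ j :: (B ++ L.flatMap f)))) :
    ∃ v p u z : ℕ, 1 ≤ v ∧ v < p ∧ p < u ∧ u < z ∧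
      ∀ π, π = wordPerm (A ++ j :: (M ++ j :: (B ++ L.flatMap f))) →
        π⁻¹ v < π⁻¹ z ∧ π⁻¹ z < π⁻¹ u ∧ π⁻¹ u < π⁻¹ p := by
  have hasc' := hasc
  simp only [isAscending_append, IsAscending, one_mul] at hasc
  obtain ⟨-, hpu, -, huz, hlast⟩ := hasc
  rw [← isAscending_append] at hlast
  set σ := wordPerm A with hσ
  set σ₂ := σ * Equiv.swap j (j + 1) * wordPerm M with hσ₂
  set σ₃ := σ₂ * Equiv.swap j (j + 1) with hσ₃
  set σ₄ := σ₃ * wordPerm B with hσ₄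
  have hu : σ₂ j = σ (j + 1) := by
    simp [hσ₂, wordPerm_apply_of_ne hM]
  have hfix : ∀ v ≤ t, σ v = v := fun v hv =>
    wordPerm_apply_of_ne fun a ha => by have := hA a ha; omega
  have htp : t < σ j := by
    by_contra hcon
    have := σ.injective (hfix (σ j) (by omega))
    omega
  have hBz : (σ₄)⁻¹ (σ₂ (j + 1)) = j := by
    have hBj : wordPerm B j = j :=
      wordPerm_apply_of_ne fun a ha => by have := hB a ha; omega
    rw [Equiv.Perm.inv_eq_iff_eq, hσ₄, Equiv.Perm.mul_apply σ₃, hBj, hσ₃]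
    simp
  have hbefore : valuesBefore t (σ₂ (j + 1)) σ₄ = Finset.Icc 1 t := by
    refine Finset.filter_true_of_mem fun v hv => ?_
    rw [Finset.mem_Icc] at hv
    rw [hBz]
    have h4 : σ₄ = σ * wordPerm (j :: (M ++ j :: B)) := by
      simp [hσ₄, hσ₃, hσ₂, mul_assoc]
    have hv' : σ⁻¹ v = v := by rw [Equiv.Perm.inv_eq_iff_eq, hfix v hv.2]
    rw [h4, mul_inv_rev, Equiv.Perm.mul_apply, hv']
    refine wordPerm_inv_lt (fun a ha => ?_) (by omega)
    simp only [List.mem_cons, List.mem_append] at ha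
    rcases ha with rfl | ha | rfl | ha
    · omega
    · exact (hM a ha).2
    · omega
    · have := hB a ha
      omega
  have hcard := card_valuesBefore_le_of_flatMap (t := t) (z := σ₂ (j + 1)) hf L σ₄
  rw [hbefore, Nat.card_Icc] at hcard
  obtain ⟨v, hv⟩ : (valuesBefore t (σ₂ (j + 1)) (σ₄ * wordPerm (L.flatMap f))).Nonempty := by
    rw [← Finset.card_pos]
    omega
  simp only [valuesBefore, Finset.mem_filter, Finset.mem_Icc] at hv
  refine ⟨v, σ j, σ (j + 1), σ₂ (j + 1), hv.1.1, by omega, hpu, by omega, ?_⟩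
  rintro π rfl
  refine ⟨?_, ?_, ?_⟩
  · convert hv.2 using 3 <;> simp [hσ₄, hσ₃, hσ₂, hσ, mul_assoc]
  · have h := hlast.inv_lt_inv (x := σ₂ j) (y := σ₂ (j + 1)) huz (by simp [hσ₃, mul_inv_rev])
    rw [hu] at h
    convert h using 3 <;> simp [hσ₃, hσ₂, hσ, mul_assoc]
  · have h1 := (isAscending_append.1 hasc').2
    simp only [one_mul, ← hσ] at h1
    have h := h1.2.inv_lt_inv (x := σ j) (y := σ (j + 1)) hpu (by simp [mul_inv_rev])
    convert h using 3 <;> simp [hσ, mul_assoc]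

/-- Two consecutive indices where `f` holds, with `g` failing between them, must exist as soon as
`f` holds at least twice more often than `g`. -/
lemma exists_gap_of_card {f g : ℕ → Prop} [DecidablePred f] [DecidablePred g] {m : ℕ}
    (h : 1 + (∑ k ∈ Finset.range m, if g k then 1 else 0) <
      ∑ k ∈ Finset.range m, if f k then 1 else 0) :
    ∃ a b, a < b ∧ b < m ∧ f a ∧ f b ∧ (∀ k, a < k → k < b → ¬ f k) ∧
      ∀ k, a < k → k ≤ b → ¬ g k := by
  by_contra hcon
  push Not at hcon
  have key : ∀ i ≤ m,
      (∑ k ∈ Finset.range i, if f k then 1 else 0) ≤ (∑ k ∈ Finset.range i, if g k then 1 else 0) ∨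
      ((∑ k ∈ Finset.range i, if f k then 1 else 0) ≤
        1 + (∑ k ∈ Finset.range i, if g k then 1 else 0) ∧
        ∃ a < i, f a ∧ ∀ k, a < k → k < i → ¬ f k ∧ ¬ g k) := by
    intro i
    induction i with
    | zero => simp
    | succ i ih =>
      intro hi
      have ih := ih (by omega)
      rw [Finset.sum_range_succ, Finset.sum_range_succ]
      by_cases hg : g i <;> by_cases hf : f i <;> simp only [hg, hf, if_true, if_false]
      · rcases ih with ih | ⟨ih, -⟩
        · left; omega
        · exact Or.inr ⟨by omega, i, by omega, hf, fun k _ _ => by omega⟩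
      · left; omega
      · rcases ih with ih | ⟨ih, a, ha, hfa, hk⟩
        · exact Or.inr ⟨by omega, i, by omega, hf, fun k _ _ => by omega⟩
        · obtain ⟨k, hak, hki, hgk⟩ := hcon a i ha (by omega) hfa hf fun k h1 h2 => (hk k h1 h2).1
          rcases hki.lt_or_eq with hlt | rfl
          · exact absurd hgk (hk k hak hlt).2
          · exact absurd hgk hg
      · rcases ih with ih | ⟨ih, a, ha, hfa, hk⟩
        · left; omega
        · refine Or.inr ⟨by omega, a, by omega, hfa, fun k h1 h2 => ?_⟩
          rcases (Nat.lt_succ_iff.1 h2).lt_or_eq with hlt | rfl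
          · exact hk k h1 hlt
          · exact ⟨hf, hg⟩
  rcases key m le_rfl with h' | ⟨h', -⟩ <;> omega

/-- The part of the reading word coming from row `r + 1`. -/
def rowWord (n : ℕ) (C : Finset (ℕ × ℕ)) (r : ℕ) : List ℕ :=
  (List.range n).filterMap fun c => if (r + 1, c + 1) ∈ C then some (r + c + 1) else none

lemma mem_rowWord {n : ℕ} {C : Finset (ℕ × ℕ)} {r a : ℕ} :
    a ∈ rowWord n C r ↔ ∃ c < n, (r + 1, c + 1) ∈ C ∧ r + c + 1 = a := by
  simp [rowWord]

lemma rowWord_sorted (n : ℕ) (C : Finset (ℕ × ℕ)) (r : ℕ) :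
    (rowWord n C r).Pairwise (· < ·) := by
  refine List.Pairwise.filterMap _ (fun c c' hc a ha a' ha' => ?_) List.pairwise_lt_range
  split_ifs at ha ha'
  all_goals simp_all
  omega

lemma readingWord_eq (n : ℕ) (C : Finset (ℕ × ℕ)) :
    readingWord n C = (List.range (n - 1)).reverse.flatMap (rowWord n C) := rfl

lemma exists_rowWord_eq {n : ℕ} {C : Finset (ℕ × ℕ)} {r j : ℕ} (h : j ∈ rowWord n C r) :
    ∃ X Y, rowWord n C r = X ++ j :: Y ∧ (∀ a ∈ X, a < j) ∧ ∀ a ∈ Y, j < a := by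
  obtain ⟨X, Y, hXY⟩ := List.append_of_mem h
  have hs := rowWord_sorted n C r
  rw [hXY, List.pairwise_append, List.pairwise_cons] at hs
  exact ⟨X, Y, hXY, fun a ha => hs.2.2 a ha j (by simp), hs.2.1.1⟩

lemma reverse_range_eq {N r s : ℕ} (hr : r < s) (hs : s < N) :
    (List.range N).reverse = (List.range' (s + 1) (N - s - 1)).reverse ++
      s :: ((List.range' (r + 1) (s - r - 1)).reverse ++ r :: (List.range r).reverse) := by
  have h : List.range N = List.range r ++ r :: (List.range' (r + 1) (s - r - 1) ++
      s :: List.range' (s + 1) (N - s - 1)) := by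
    obtain ⟨k, rfl⟩ := Nat.exists_eq_add_of_lt hr
    obtain ⟨m, rfl⟩ := Nat.exists_eq_add_of_lt hs
    have h1 : r + k + 1 + m + 1 = r + ((k + 1) + (m + 1)) := by omega
    have h2 : r + k + 1 - r - 1 = k := by omega
    have h3 : r + k + 1 + m + 1 - (r + k + 1) - 1 = m := by omega
    rw [h2, h3, h1, List.range_eq_range', List.range_eq_range', ← List.range'_append_1,
      ← List.range'_append_1, List.range'_succ, List.range'_succ]
    simp [Nat.add_assoc]
  rw [h]
  simp

/-- A violated inequality of `SatisfiesTSSCPP` gives a pattern 1432. -/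
lemma not_avoids1432_of_violation {n : ℕ} {π : Equiv.Perm ℕ} {C : Finset (ℕ × ℕ)}
    (hπ : ∀ m : ℕ, m = 0 ∨ n < m → π m = m) (hC : IsReducedPipeDream n π C) {i j : ℕ}
    (hij : i < j) (hj : j ≤ n - 1)
    (h : 1 + (∑ k ∈ Finset.Icc 1 i, if (j - k, k) ∈ C then 1 else 0) <
      ∑ k ∈ Finset.Icc 1 (i + 1), if (j - k + 1, k) ∈ C then 1 else 0) :
    ¬ Avoids1432 n π := by
  obtain ⟨hpd, hprod, hlen⟩ := hC
  have hzero : (j - 0, 0) ∉ C := fun hmem => by have := (hpd _ hmem).2.1; omega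
  have hg : (∑ k ∈ Finset.Icc 1 i, if (j - k, k) ∈ C then 1 else 0) =
      ∑ k ∈ Finset.range (i + 1), if (j - k, k) ∈ C then 1 else 0 := by
    rw [Finset.sum_range_succ', if_neg hzero, add_zero, ← Finset.Ico_add_one_right_eq_Icc,
      Finset.sum_Ico_eq_sum_range]
    simp [add_comm]
  have hf : (∑ k ∈ Finset.Icc 1 (i + 1), if (j - k + 1, k) ∈ C then 1 else 0) =
      ∑ k ∈ Finset.range (i + 1), if (j - k, k + 1) ∈ C then 1 else 0 := by
    rw [← Finset.Ico_add_one_right_eq_Icc, Finset.sum_Ico_eq_sum_range]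
    refine Finset.sum_congr (by simp) fun k hk => ?_
    rw [Finset.mem_range] at hk
    rw [show j - (1 + k) + 1 = j - k by omega, add_comm 1 k]
  rw [hg, hf] at h
  obtain ⟨a, b, hab, hbi, ha, hb, hfgap, hggap⟩ := exists_gap_of_card h
  have hletters : ∀ c ∈ readingWord n C, 1 ≤ c ∧ c + 1 ≤ n := by
    intro c hc
    simp only [readingWord_eq, List.mem_flatMap, mem_rowWord] at hc
    obtain ⟨r, -, c', -, hmem, rfl⟩ := hc
    have := hpd _ hmem
    simp only at this
    omega
  have hasc : IsAscending 1 (readingWord n C) := by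
    refine isAscending_of_le_card (n := n) hletters ?_
    have hone : inversions n 1 = ∅ :=
      Finset.filter_false_of_mem fun p _ => by simpa using fun h => h.le
    rw [hone, one_mul, Finset.card_empty, zero_add, hlen, ← hprod]
    rfl
  have hsplit := reverse_range_eq (r := j - b - 1) (s := j - a - 1) (N := n - 1)
    (by omega) (by omega)
  obtain ⟨X, Y, hXY, -, hY⟩ := exists_rowWord_eq (n := n) (C := C) (r := j - a - 1) (j := j)
    (mem_rowWord.2 ⟨a, by omega, by rwa [show j - a - 1 + 1 = j - a by omega], by omega⟩)
  obtain ⟨X', Y', hXY', hX', hY'⟩ := exists_rowWord_eq (n := n) (C := C) (r := j - b - 1) (j := j)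
    (mem_rowWord.2 ⟨b, by omega, by rwa [show j - b - 1 + 1 = j - b by omega], by omega⟩)
  set top := (List.range' (j - a - 1 + 1) (n - 1 - (j - a - 1) - 1)).reverse.flatMap (rowWord n C)
    with htop
  set mid := (List.range' (j - b - 1 + 1) (j - a - 1 - (j - b - 1) - 1)).reverse.flatMap
    (rowWord n C) with hmid
  have hword : readingWord n C = (top ++ X) ++ j :: ((Y ++ mid ++ X') ++ j ::
      (Y' ++ (List.range (j - b - 1)).reverse.flatMap (rowWord n C))) := by
    rw [readingWord_eq, hsplit]
    simp [htop, hmid, hXY, hXY']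
  rw [hword] at hasc
  have hnotleft : ∀ k, a < k → k ≤ b → ∀ r, r = j - k - 1 → ∀ c ∈ rowWord n C r, c + 1 ≠ j := by
    rintro k hk hk' r rfl c hc rfl
    obtain ⟨c', -, hmem, hc'⟩ := mem_rowWord.1 hc
    refine hggap k hk hk' ?_
    convert hmem using 2 <;> omega
  have htopX : ∀ c ∈ top ++ X, j - a - 1 < c := by
    intro c hc
    rw [List.mem_append] at hc
    rcases hc with hc | hc
    · simp only [htop, List.mem_flatMap, List.mem_reverse, List.mem_range'_1, mem_rowWord] at hc
      obtain ⟨r, hr, c', -, -, rfl⟩ := hc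
      omega
    · have hc' : c ∈ rowWord n C (j - a - 1) := by simp [hXY, hc]
      obtain ⟨c', -, -, rfl⟩ := mem_rowWord.1 hc'
      omega
  have hmidX : ∀ c ∈ Y ++ mid ++ X', c ≠ j ∧ c + 1 ≠ j := by
    intro c hc
    rw [List.mem_append, List.mem_append] at hc
    rcases hc with (hc | hc) | hc
    · have := hY c hc
      omega
    · simp only [hmid, List.mem_flatMap, List.mem_reverse, List.mem_range'_1] at hc
      obtain ⟨r, hr, hc⟩ := hc
      refine ⟨?_, hnotleft (j - r - 1) (by omega) (by omega) r (by omega) c hc⟩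
      rintro rfl
      obtain ⟨c', -, hmem, hc'⟩ := mem_rowWord.1 hc
      refine hfgap (c - r - 1) (by omega) (by omega) ?_
      convert hmem using 2 <;> omega
    · refine ⟨(hX' c hc).ne, hnotleft b hab le_rfl _ rfl c ?_⟩
      simp [hXY', hc]
  obtain ⟨v, p, u, z, hv, hvp, hpu, huz, hpat⟩ := exists_pattern_of_word
    (t := j - a - 1) (rowWord_sorted n C) (by omega) (by simp; omega) htopX hmidX hY' hasc
  obtain ⟨h1, h2, h3⟩ := hpat π (by rw [← hword, ← hprod]; rfl)
  refine not_not.2 ⟨π⁻¹ v, π⁻¹ z, π⁻¹ u, π⁻¹ p, ?_, h1, h2, h3, ?_, by simpa using hvp,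
    by simpa using hpu, by simpa using huz⟩
  · by_contra hcon
    have h0 : π (π⁻¹ v) = π⁻¹ v := hπ _ (by omega)
    rw [show π (π⁻¹ v) = v by simp] at h0
    omega
  · by_contra hcon
    have h0 : π (π⁻¹ p) = π⁻¹ p := hπ _ (by omega)
    rw [show π (π⁻¹ p) = p by simp] at h0
    have h0' : π⁻¹ u = u := by
      rw [Equiv.Perm.inv_eq_iff_eq, hπ u (by omega)]
    omega

/-- If `π` is a permutation of `{1,…,n}` avoiding the pattern 1432, then every
reduced pipe dream for `π` satisfies the TSSCPP inequalities; consequently, the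
set of pipe dreams satisfying the TSSCPP inequalities that are reduced pipe
dreams for `π` is exactly the set of all reduced pipe dreams for `π`. -/
theorem satisfiesTSSCPP_of_reduced_of_avoids1432 (n : ℕ) (π : Equiv.Perm ℕ)
    (hπ : ∀ m : ℕ, m = 0 ∨ n < m → π m = m)
    (hav : Avoids1432 n π) :
    (∀ C : Finset (ℕ × ℕ), IsReducedPipeDream n π C → SatisfiesTSSCPP n C) ∧
    {C : Finset (ℕ × ℕ) | SatisfiesTSSCPP n C ∧ IsReducedPipeDream n π C} =
      {C : Finset (ℕ × ℕ) | IsReducedPipeDream n π C} := by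
  have key : ∀ C : Finset (ℕ × ℕ), IsReducedPipeDream n π C → SatisfiesTSSCPP n C := by
    intro C hC i j _ hij hj
    by_contra hcon
    exact not_avoids1432_of_violation hπ hC hij hj (not_le.1 hcon) hav
  exact ⟨key, Set.ext fun C => ⟨And.right, fun hC => ⟨key C hC, hC⟩⟩⟩
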